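/- arXiv:2306.14661 — 6 statements merged into one kernel-verified Lean document; each statement's English description precedes it below -/
import Mathlib

section
/- For every scaling vector Υ ∈ R^n_{++} and every x ∈ {0,1}^n with e^⊤x = s, Ax ≤ b, and C[S(x),S(x)] positive definite, one has ldet C[S(x),S(x)] ≤ z_BQP(Υ). Consequently the optimal value of CMESP is at most the g-scaled BQP bound z_BQP(Υ). (Theorem 1.i) -/
open Matrix
open scoped Matrix BigOperators

noncomputable section

/-- `F_BQP(x,X;Υ) = (Diag(Υ) C Diag(Υ)) ∘ X + Diag(e−x)`. -/
def FBQP (n : ℕ) (C : Matrix (Fin n) (Fin n) ℝ) (x : Fin n → ℝ)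
    (X : Matrix (Fin n) (Fin n) ℝ) (Υ : Fin n → ℝ) : Matrix (Fin n) (Fin n) ℝ :=
  ((Matrix.diagonal Υ * C * Matrix.diagonal Υ) ⊙ X) + Matrix.diagonal (fun i => 1 - x i)

/-- `f_BQP(x,X;Υ) = ldet F_BQP(x,X;Υ) − 2 Σ_i x_i log γ_i`. -/
def fBQP (n : ℕ) (C : Matrix (Fin n) (Fin n) ℝ) (x : Fin n → ℝ)
    (X : Matrix (Fin n) (Fin n) ℝ) (Υ : Fin n → ℝ) : ℝ :=
  Real.log (FBQP n C x X Υ).det - 2 * ∑ i, x i * Real.log (Υ i)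

/-- The set of objective values of feasible points of the g-scaled BQP relaxation:
`(x,X) ∈ P(n,s) ∩ dom(f_BQP;Υ)` and `Ax ≤ b`. -/
def SBQP (n m : ℕ) (C : Matrix (Fin n) (Fin n) ℝ) (A : Matrix (Fin m) (Fin n) ℝ)
    (b : Fin m → ℝ) (s : ℕ) (Υ : Fin n → ℝ) : Set ℝ :=
  { v : ℝ | ∃ (x : Fin n → ℝ) (X : Matrix (Fin n) (Fin n) ℝ),
      X.IsSymm ∧ (X - Matrix.vecMulVec x x).PosSemidef ∧ X.diag = x ∧
      (∑ i, x i) = (s : ℝ) ∧ (∀ i, (∑ j, X i j) = (s : ℝ) * x i) ∧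
      (∀ i, (∑ j, A i j * x j) ≤ b i) ∧ (FBQP n C x X Υ).PosDef ∧
      v = fBQP n C x X Υ }

/-- The g-scaled BQP bound `z_BQP(Υ)`. -/
def zBQP (n m : ℕ) (C : Matrix (Fin n) (Fin n) ℝ) (A : Matrix (Fin m) (Fin n) ℝ)
    (b : Fin m → ℝ) (s : ℕ) (Υ : Fin n → ℝ) : ℝ :=
  sSup (SBQP n m C A b s Υ)

/-- For a positive definite matrix, `log det M ≤ tr M - n`. -/
lemma Matrix.PosDef.log_det_le_trace_sub_card {ι : Type*} [Fintype ι] [DecidableEq ι]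
    {M : Matrix ι ι ℝ} (hM : M.PosDef) :
    Real.log M.det ≤ M.trace - Fintype.card ι := by
  have hdet := hM.isHermitian.det_eq_prod_eigenvalues
  have htr := hM.isHermitian.trace_eq_sum_eigenvalues
  simp only [RCLike.ofReal_real_eq_id, id_eq] at hdet htr
  rw [hdet, htr, Real.log_prod fun i _ => (hM.eigenvalues_pos i).ne']
  calc ∑ i, Real.log (hM.isHermitian.eigenvalues i)
      ≤ ∑ i, (hM.isHermitian.eigenvalues i - 1) :=
        Finset.sum_le_sum fun i _ => Real.log_le_sub_one_of_pos (hM.eigenvalues_pos i)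
    _ = _ := by simp

lemma FBQP_apply (n : ℕ) (C : Matrix (Fin n) (Fin n) ℝ) (x : Fin n → ℝ)
    (X : Matrix (Fin n) (Fin n) ℝ) (Υ : Fin n → ℝ) (i j : Fin n) :
    FBQP n C x X Υ i j = Υ i * C i j * Υ j * X i j + if i = j then 1 - x i else 0 := by
  simp [FBQP, Matrix.diagonal_apply]

/-- The objective values of the BQP relaxation are bounded above. -/
lemma bddAbove_SBQP (n m : ℕ) (C : Matrix (Fin n) (Fin n) ℝ) (hC : C.PosSemidef)
    (A : Matrix (Fin m) (Fin n) ℝ) (b : Fin m → ℝ) (s : ℕ) (Υ : Fin n → ℝ) :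
    BddAbove (SBQP n m C A b s Υ) := by
  refine ⟨∑ i, (Υ i * C i i * Υ i + 2 * |Real.log (Υ i)|), ?_⟩
  rintro v ⟨x, X, -, hX, hdiag, -, -, -, hF, rfl⟩
  have hXx : ∀ i, X i i = x i := fun i => congrFun hdiag i
  have hx : ∀ i, 0 ≤ x i ∧ x i ≤ 1 := by
    intro i
    have h := hX.diag_nonneg (i := i)
    simp only [Matrix.sub_apply, Matrix.vecMulVec_apply, hXx] at h
    constructor <;> nlinarith
  have htr : (FBQP n C x X Υ).trace - n = ∑ i, (Υ i * C i i * Υ i * x i - x i) := by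
    simp only [Matrix.trace, Matrix.diag_apply, FBQP_apply, hXx, if_true,
      Finset.sum_add_distrib, Finset.sum_sub_distrib]
    simp
    ring
  have hlog := hF.log_det_le_trace_sub_card
  rw [Fintype.card_fin, htr] at hlog
  have hterm : ∑ i, (Υ i * C i i * Υ i * x i - x i) - 2 * ∑ i, x i * Real.log (Υ i) ≤
      ∑ i, (Υ i * C i i * Υ i + 2 * |Real.log (Υ i)|) := by
    rw [Finset.mul_sum, ← Finset.sum_sub_distrib]
    refine Finset.sum_le_sum fun i _ => ?_
    obtain ⟨h0, h1⟩ := hx i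
    have hc : 0 ≤ Υ i * C i i * Υ i := by
      have := mul_nonneg (hC.diag_nonneg (i := i)) (mul_self_nonneg (Υ i))
      linarith
    have ha := neg_abs_le (Real.log (Υ i))
    have hb := abs_nonneg (Real.log (Υ i))
    nlinarith [mul_le_mul_of_nonneg_left ha h0]
  unfold fBQP
  linarith

/-- At the binary point with support `S`, the determinant of `F_BQP` is that of the scaled
principal submatrix `C[S,S]`. -/
lemma det_FBQP_indicator (n : ℕ) (C : Matrix (Fin n) (Fin n) ℝ) (Υ : Fin n → ℝ)
    (S : Finset (Fin n)) (x : Fin n → ℝ) (hx : ∀ i, x i = if i ∈ S then 1 else 0) :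
    (FBQP n C x (Matrix.vecMulVec x x) Υ).det =
      (∏ i ∈ S, Υ i) ^ 2 * (C.submatrix (fun i : {i // i ∈ S} => i.1)
        (fun i : {i // i ∈ S} => i.1)).det := by
  have hblock : (FBQP n C x (Matrix.vecMulVec x x) Υ).submatrix
      (Equiv.sumCompl (· ∈ S)) (Equiv.sumCompl (· ∈ S)) =
      Matrix.fromBlocks (Matrix.diagonal (fun i : {i // i ∈ S} => Υ i) *
        C.submatrix (fun i : {i // i ∈ S} => i.1) (fun i : {i // i ∈ S} => i.1) *
        Matrix.diagonal (fun i : {i // i ∈ S} => Υ i)) 0 0 1 := by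
    ext (i | i) (j | j)
    · simp [FBQP_apply, Matrix.vecMulVec_apply, hx, i.2, j.2]
    · have hij : i.1 ≠ j.1 := fun h => j.2 (h ▸ i.2)
      simp [FBQP_apply, Matrix.vecMulVec_apply, hx, i.2, j.2, hij]
    · have hij : i.1 ≠ j.1 := fun h => i.2 (h ▸ j.2)
      simp [FBQP_apply, Matrix.vecMulVec_apply, hx, i.2, j.2, hij]
    · simp [FBQP_apply, Matrix.vecMulVec_apply, hx, i.2, j.2, Matrix.one_apply, Subtype.ext_iff]
  rw [← Matrix.det_submatrix_equiv_self (Equiv.sumCompl (· ∈ S)), hblock,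
    Matrix.det_fromBlocks_zero₂₁, Matrix.det_mul, Matrix.det_mul, Matrix.det_diagonal,
    Matrix.det_one, Finset.prod_coe_sort S Υ]
  ring

lemma posSemidef_FBQP_vecMulVec (n : ℕ) (C : Matrix (Fin n) (Fin n) ℝ) (hC : C.PosSemidef)
    (Υ x : Fin n → ℝ) (hx : ∀ i, x i ≤ 1) :
    (FBQP n C x (Matrix.vecMulVec x x) Υ).PosSemidef := by
  have hF : FBQP n C x (Matrix.vecMulVec x x) Υ =
      (Matrix.diagonal fun i => Υ i * x i)ᴴ * C * Matrix.diagonal (fun i => Υ i * x i) +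
        Matrix.diagonal fun i => 1 - x i := by
    ext i j
    simp [FBQP_apply, Matrix.vecMulVec_apply, Matrix.diagonal_apply]
    ring
  rw [hF]
  exact (hC.conjTranspose_mul_mul_same _).add
    (Matrix.PosSemidef.diagonal fun i => sub_nonneg.2 (hx i))

/-- Theorem 1.i: the g-scaled BQP bound is a valid upper bound for CMESP. -/
theorem stmt_0 (n m s : ℕ) (hn : 1 < n) (hs0 : 0 < s) (hsn : s < n)
    (C : Matrix (Fin n) (Fin n) ℝ) (hC : C.PosSemidef)
    (A : Matrix (Fin m) (Fin n) ℝ) (b : Fin m → ℝ)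
    (Υ : Fin n → ℝ) (hΥ : ∀ i, 0 < Υ i)
    (S : Finset (Fin n)) (hcard : S.card = s)
    (x : Fin n → ℝ) (hx : ∀ i, x i = if i ∈ S then 1 else 0)
    (hAx : ∀ i, (∑ j, A i j * x j) ≤ b i)
    (hpd : (C.submatrix (fun i : {i // i ∈ S} => i.1)
              (fun i : {i // i ∈ S} => i.1)).PosDef) :
    Real.log (C.submatrix (fun i : {i // i ∈ S} => i.1)
              (fun i : {i // i ∈ S} => i.1)).det ≤ zBQP n m C A b s Υ := by
  have hprod : 0 < ∏ i ∈ S, Υ i := Finset.prod_pos fun i _ => hΥ i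
  have hdet := det_FBQP_indicator n C Υ S x hx
  have hx1 : ∀ i, x i ≤ 1 := fun i => by rw [hx]; split_ifs <;> norm_num
  have hxx : ∀ i, x i * x i = x i := fun i => by rw [hx]; split_ifs <;> norm_num
  have hsum : ∑ i, x i = (s : ℝ) := by simp [hx, hcard]
  have hF : (FBQP n C x (Matrix.vecMulVec x x) Υ).PosDef := by
    rw [(posSemidef_FBQP_vecMulVec n C hC Υ x hx1).posDef_iff_det_ne_zero, hdet]
    exact (mul_pos (pow_pos hprod 2) hpd.det_pos).ne'
  refine le_csSup (bddAbove_SBQP n m C hC A b s Υ) ⟨x, Matrix.vecMulVec x x, ?_, ?_, ?_, hsum,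
    ?_, hAx, hF, ?_⟩
  · ext i j
    simp [Matrix.vecMulVec_apply, mul_comm]
  · rw [sub_self]
    exact Matrix.PosSemidef.zero
  · ext i
    simp [Matrix.vecMulVec_apply, hxx]
  · intro i
    simp only [Matrix.vecMulVec_apply, ← Finset.mul_sum, hsum, mul_comm]
  · have hlog : ∑ i, x i * Real.log (Υ i) = ∑ i ∈ S, Real.log (Υ i) := by
      simp [hx]
    rw [fBQP, hdet, Real.log_mul (pow_pos hprod 2).ne' hpd.det_pos.ne', Real.log_pow,
      Real.log_prod fun i _ => (hΥ i).ne', hlog]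
    push_cast
    ring

end
end

section
/- Fix (x,X) with 0 ≤ x ≤ e and X ⪰ 0 such that F_BQP(x,X;Υ) ≻ 0. Then the map ψ ↦ f_BQP(x,X; exp(ψ)) (exp applied componentwise) is convex on the open set {ψ ∈ R^n : F_BQP(x,X;exp(ψ)) ≻ 0}; that is, f_BQP(x,X;Υ) is convex in log Υ. (Theorem 1.iii, first part) -/
open Matrix
open scoped Matrix BigOperators

noncomputable section

theorem Matrix.det_add_eq_sum_det_piecewise {ι R : Type*} [Fintype ι] [DecidableEq ι] [CommRing R]
    (A B : Matrix ι ι R) :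
    (A + B).det = ∑ s : Finset ι, (Matrix.of (s.piecewise A B)).det :=
  (detRowAlternating : (ι → R) [⋀^ι]→ₗ[R] R).toMultilinearMap.map_add_univ A B

theorem Matrix.PosSemidef.det_piecewise_diagonal_nonneg {ι : Type*} [Fintype ι] [DecidableEq ι]
    {M : Matrix ι ι ℝ} (hM : M.PosSemidef) {d : ι → ℝ} (hd : ∀ i, 0 ≤ d i) (s : Finset ι) :
    0 ≤ (Matrix.of (s.piecewise M (diagonal d))).det := by
  have hin : (Matrix.of (s.piecewise M (diagonal d))).toSquareBlockProp (· ∈ s) =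
      M.submatrix (fun i : {i // i ∈ s} => (i : ι)) (fun i : {i // i ∈ s} => (i : ι)) := by
    ext i j
    simp [toSquareBlockProp, Finset.piecewise, i.2]
  have hout : (Matrix.of (s.piecewise M (diagonal d))).toSquareBlockProp (fun i => ¬ i ∈ s) =
      diagonal fun i : {i // ¬ i ∈ s} => d i := by
    ext i j
    simp [toSquareBlockProp, Finset.piecewise, i.2, diagonal_apply, Subtype.ext_iff]
  rw [twoBlockTriangular_det _ (· ∈ s), hin, hout, det_diagonal]
  · refine mul_nonneg ?_ (Finset.prod_nonneg fun i _ => hd i)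
    have hdet : 0 ≤ (M.submatrix (fun i : {i // i ∈ s} => (i : ι))
        (fun i : {i // i ∈ s} => (i : ι))).det :=
      (hM.submatrix _).det_nonneg
    convert! hdet
  · intro i hi j hj
    have hij : i ≠ j := fun h => hi (h ▸ hj)
    simp [Finset.piecewise, hi, diagonal_apply_ne _ hij]

theorem Matrix.det_piecewise_exp_scaling {ι : Type*} [Fintype ι] [DecidableEq ι]
    (M : Matrix ι ι ℝ) (d ψ : ι → ℝ) (s : Finset ι) :
    (Matrix.of (s.piecewise (Matrix.of fun i j => Real.exp (ψ i) * M i j * Real.exp (ψ j))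
      (diagonal d))).det =
      (Matrix.of (s.piecewise M (diagonal d))).det * Real.exp (∑ i ∈ s, 2 * ψ i) := by
  have hfac : Matrix.of (s.piecewise
      (Matrix.of fun i j => Real.exp (ψ i) * M i j * Real.exp (ψ j)) (diagonal d)) =
      diagonal (fun i => Real.exp (if i ∈ s then ψ i else -ψ i)) *
        Matrix.of (s.piecewise M (diagonal d)) * diagonal (fun i => Real.exp (ψ i)) := by
    ext i j
    rw [mul_diagonal, diagonal_mul]
    by_cases hi : i ∈ s
    · simp [Finset.piecewise, hi]
    · by_cases hij : i = j
      · subst hij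
        simp only [of_apply, Finset.piecewise, hi, if_false, diagonal_apply_eq]
        rw [mul_right_comm, ← Real.exp_add]
        simp
      · simp [Finset.piecewise, hi, hij]
  rw [hfac, det_mul, det_mul, det_diagonal, det_diagonal, mul_right_comm, ← Finset.prod_mul_distrib,
    mul_comm]
  congr 1
  simp_rw [← Real.exp_add]
  rw [← Real.exp_sum, ← Finset.sum_subset s.subset_univ]
  · congr 1
    refine Finset.sum_congr rfl fun i hi => ?_
    rw [if_pos hi]
    ring
  · intro i _ hi
    simp [hi]

theorem convexOn_log_sum_mul_exp {ι E : Type*} [AddCommGroup E] [Module ℝ E] (t : Finset ι)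
    {c : ι → ℝ} (hc : ∀ i ∈ t, 0 ≤ c i) (l : ι → E →ₗ[ℝ] ℝ) :
    ConvexOn ℝ {v | 0 < ∑ i ∈ t, c i * Real.exp (l i v)}
      (fun v => Real.log (∑ i ∈ t, c i * Real.exp (l i v))) := by
  have hpos (u v : E) (hu : 0 < ∑ i ∈ t, c i * Real.exp (l i u)) :
      0 < ∑ i ∈ t, c i * Real.exp (l i v) := by
    obtain ⟨i, hi, hci⟩ := Finset.exists_lt_of_sum_lt (f := fun _ => (0 : ℝ)) (by simpa using hu)
    have hci : 0 < c i := pos_of_mul_pos_left hci (Real.exp_pos _).le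
    exact Finset.sum_pos' (fun j hj => mul_nonneg (hc j hj) (Real.exp_pos _).le)
      ⟨i, hi, mul_pos hci (Real.exp_pos _)⟩
  refine ⟨fun u hu v _ a b _ _ _ => hpos u _ hu, fun u hu v hv a b ha hb hab => ?_⟩
  rw [Set.mem_ofPred_eq] at hu hv
  simp only [smul_eq_mul]
  set U := ∑ i ∈ t, c i * Real.exp (l i u) with hU
  set V := ∑ i ∈ t, c i * Real.exp (l i v) with hV
  rw [Real.log_le_iff_le_exp (hpos u _ hu)]
  have hterm (i : ι) (hi : i ∈ t) : c i * Real.exp (l i (a • u + b • v)) ≤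
      Real.exp (a * Real.log U + b * Real.log V) *
        (a / U * (c i * Real.exp (l i u)) + b / V * (c i * Real.exp (l i v))) := by
    have h := convexOn_exp.2 (Set.mem_univ (l i u - Real.log U))
      (Set.mem_univ (l i v - Real.log V)) ha hb hab
    simp only [smul_eq_mul, Real.exp_sub, Real.exp_log hu, Real.exp_log hv] at h
    have hsplit : l i (a • u + b • v) = (a * Real.log U + b * Real.log V) +
        (a * (l i u - Real.log U) + b * (l i v - Real.log V)) := by
      simp only [map_add, map_smul, smul_eq_mul]
      ring
    rw [hsplit, Real.exp_add]
    calc _ ≤ c i * (Real.exp (a * Real.log U + b * Real.log V) *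
          (a * (Real.exp (l i u) / U) + b * (Real.exp (l i v) / V))) := by
            gcongr
            exact hc i hi
      _ = _ := by ring
  refine (Finset.sum_le_sum hterm).trans_eq ?_
  rw [← Finset.mul_sum, Finset.sum_add_distrib, ← Finset.mul_sum, ← Finset.mul_sum, ← hU, ← hV,
    div_mul_cancel₀ _ hu.ne', div_mul_cancel₀ _ hv.ne', hab, mul_one]

theorem FBQP_posSemidef {n : ℕ} {C X : Matrix (Fin n) (Fin n) ℝ} {x : Fin n → ℝ}
    (hC : C.PosSemidef) (hx1 : ∀ i, x i ≤ 1) (hX : X.PosSemidef) (Υ : Fin n → ℝ) :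
    (FBQP n C x X Υ).PosSemidef := by
  refine PosSemidef.add (PosSemidef.hadamard ?_ hX)
    (PosSemidef.diagonal fun i => sub_nonneg.2 (hx1 i))
  simpa [diagonal_conjTranspose] using hC.conjTranspose_mul_mul_same (diagonal Υ)

theorem det_FBQP_exp {n : ℕ} (C X : Matrix (Fin n) (Fin n) ℝ) (x ψ : Fin n → ℝ) :
    (FBQP n C x X (fun i => Real.exp (ψ i))).det =
      ∑ s : Finset (Fin n), (Matrix.of (s.piecewise (C ⊙ X) (diagonal fun i => 1 - x i))).det *
        Real.exp ((∑ i ∈ s, (2 : ℝ) • LinearMap.proj (R := ℝ) (φ := fun _ : Fin n => ℝ) i) ψ) := by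
  have hF : FBQP n C x X (fun i => Real.exp (ψ i)) =
      (Matrix.of fun i j => Real.exp (ψ i) * (C ⊙ X) i j * Real.exp (ψ j)) +
        diagonal fun i => 1 - x i := by
    ext i j
    simp only [FBQP, Matrix.add_apply, hadamard_apply, mul_diagonal, diagonal_mul, of_apply]
    ring
  rw [hF, det_add_eq_sum_det_piecewise]
  refine Finset.sum_congr rfl fun s _ => ?_
  rw [det_piecewise_exp_scaling]
  simp [LinearMap.sum_apply]

/-- Theorem 1.iii (first part): for fixed `(x,X)` with `0 ≤ x ≤ e` and `X ⪰ 0`,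
the map `ψ ↦ f_BQP(x,X;exp ψ)` is convex on `{ψ : F_BQP(x,X;exp ψ) ≻ 0}`,
i.e. `f_BQP(x,X;Υ)` is convex in `log Υ`. -/
theorem stmt_2 (n : ℕ) (hn : 1 < n)
    (C : Matrix (Fin n) (Fin n) ℝ) (hC : C.PosSemidef)
    (x : Fin n → ℝ) (X : Matrix (Fin n) (Fin n) ℝ)
    (hx0 : ∀ i, 0 ≤ x i) (hx1 : ∀ i, x i ≤ 1) (hX : X.PosSemidef) :
    ConvexOn ℝ
      {ψ : Fin n → ℝ | (FBQP n C x X (fun i => Real.exp (ψ i))).PosDef}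
      (fun ψ => fBQP n C x X (fun i => Real.exp (ψ i))) := by
  let l : Finset (Fin n) → (Fin n → ℝ) →ₗ[ℝ] ℝ := fun s =>
    ∑ i ∈ s, (2 : ℝ) • LinearMap.proj (R := ℝ) (φ := fun _ : Fin n => ℝ) i
  let m : (Fin n → ℝ) →ₗ[ℝ] ℝ :=
    ∑ i, (2 * x i) • LinearMap.proj (R := ℝ) (φ := fun _ : Fin n => ℝ) i
  have hlog := convexOn_log_sum_mul_exp Finset.univ (fun s _ =>
    (hC.hadamard hX).det_piecewise_diagonal_nonneg (fun i => sub_nonneg.2 (hx1 i)) s) l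
  have hdom (ψ : Fin n → ℝ) : (FBQP n C x X (fun i => Real.exp (ψ i))).PosDef ↔
      0 < (FBQP n C x X (fun i => Real.exp (ψ i))).det := by
    have hF := FBQP_posSemidef hC hx1 hX (fun i => Real.exp (ψ i))
    rw [hF.posDef_iff_det_ne_zero, hF.det_nonneg.lt_iff_ne']
  simp_rw [hdom, fBQP, det_FBQP_exp, Real.log_exp]
  have hm (ψ : Fin n → ℝ) : 2 * ∑ i, x i * ψ i = m ψ := by
    simp [m, Finset.mul_sum, mul_assoc]
  simp_rw [hm]
  exact hlog.sub (m.concaveOn hlog.1)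

end
end

section
/- For every scaling vector Υ ∈ R^n_{++} and every x ∈ {0,1}^n with e^⊤x = s, Ax ≤ b, and C[S(x),S(x)] positive definite, one has ldet C[S(x),S(x)] ≤ z_linx(Υ). Consequently the optimal value of CMESP is at most the g-scaled linx bound z_linx(Υ). (Theorem 2.i) -/
open Matrix
open scoped Matrix BigOperators

noncomputable section

/-- `F_linx(x;Υ) = Diag(Υ) C Diag(x) C Diag(Υ) + Diag(e−x)`. -/
def FLinx (n : ℕ) (C : Matrix (Fin n) (Fin n) ℝ) (x Υ : Fin n → ℝ) :
    Matrix (Fin n) (Fin n) ℝ :=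
  Matrix.diagonal Υ * C * Matrix.diagonal x * C * Matrix.diagonal Υ +
    Matrix.diagonal (fun i => 1 - x i)

/-- `f_linx(x;Υ) = (1/2) ldet F_linx(x;Υ) − Σ_i x_i log γ_i`. -/
def fLinx (n : ℕ) (C : Matrix (Fin n) (Fin n) ℝ) (x Υ : Fin n → ℝ) : ℝ :=
  (1 / 2 : ℝ) * Real.log (FLinx n C x Υ).det - ∑ i, x i * Real.log (Υ i)

/-- The set of objective values of feasible points of the g-scaled linx relaxation. -/
def SLinx (n m : ℕ) (C : Matrix (Fin n) (Fin n) ℝ) (A : Matrix (Fin m) (Fin n) ℝ)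
    (b : Fin m → ℝ) (s : ℕ) (Υ : Fin n → ℝ) : Set ℝ :=
  { v : ℝ | ∃ x : Fin n → ℝ, (∑ i, x i) = (s : ℝ) ∧ (∀ i, 0 ≤ x i) ∧ (∀ i, x i ≤ 1) ∧
      (∀ i, (∑ j, A i j * x j) ≤ b i) ∧ (FLinx n C x Υ).PosDef ∧ v = fLinx n C x Υ }

/-- The g-scaled linx bound `z_linx(Υ)`. -/
def zLinx (n m : ℕ) (C : Matrix (Fin n) (Fin n) ℝ) (A : Matrix (Fin m) (Fin n) ℝ)
    (b : Fin m → ℝ) (s : ℕ) (Υ : Fin n → ℝ) : ℝ :=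
  sSup (SLinx n m C A b s Υ)

/-- A factor `B` of `F_linx(x;Υ) = Bᵀ B` at the indicator vector `x` of `S`: its rows are those of
`C Diag(Υ)` on `S` and those of the identity off `S`. -/
def linxFactor (n : ℕ) (C : Matrix (Fin n) (Fin n) ℝ) (Υ : Fin n → ℝ) (S : Finset (Fin n)) :
    Matrix (Fin n) (Fin n) ℝ :=
  Matrix.of fun i j => if i ∈ S then C i j * Υ j else if i = j then 1 else 0

theorem linxFactor_conjTranspose_mul_self (n : ℕ) (C : Matrix (Fin n) (Fin n) ℝ)
    (hC : C.IsHermitian) (Υ x : Fin n → ℝ) (S : Finset (Fin n))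
    (hx : ∀ i, x i = if i ∈ S then 1 else 0) :
    (linxFactor n C Υ S)ᴴ * linxFactor n C Υ S = FLinx n C x Υ := by
  have hsymm : ∀ i j, C i j = C j i := fun i j => by simpa using (hC.apply i j).symm
  ext i j
  have hdiag : (Matrix.diagonal fun k => 1 - x k) i j =
      ∑ k, if k ∈ S then 0 else (if k = i then 1 else 0) * (if k = j then (1 : ℝ) else 0) := by
    rw [Finset.sum_eq_single i]
    · by_cases hij : i = j
      · subst hij
        by_cases hi : i ∈ S <;> simp [hx, hi]
      · simp [hij]
    · intro k _ hk
      simp [hk]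
    · simp
  rw [FLinx, Matrix.add_apply, hdiag, Matrix.mul_diagonal, Matrix.mul_apply, Matrix.mul_apply,
    Finset.sum_mul, ← Finset.sum_add_distrib]
  refine Finset.sum_congr rfl fun k _ => ?_
  rw [Matrix.mul_diagonal, Matrix.diagonal_mul, hx, hsymm i k]
  by_cases hk : k ∈ S
  · simp [linxFactor, hk]
    ring
  · simp [linxFactor, hk]

theorem det_linxFactor (n : ℕ) (C : Matrix (Fin n) (Fin n) ℝ) (Υ : Fin n → ℝ)
    (S : Finset (Fin n)) :
    (linxFactor n C Υ S).det =
      (C.submatrix (fun i : {i // i ∈ S} => i.1) (fun i : {i // i ∈ S} => i.1)).det *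
        ∏ i ∈ S, Υ i := by
  have hoff : Matrix.toSquareBlockProp (linxFactor n C Υ S) (fun i => ¬ i ∈ S) = 1 := by
    ext i j
    simp [Matrix.toSquareBlockProp, linxFactor, i.2, Matrix.one_apply, Subtype.ext_iff]
  have hon : Matrix.toSquareBlockProp (linxFactor n C Υ S) (fun i => i ∈ S) =
      C.submatrix (fun i : {i // i ∈ S} => i.1) (fun i : {i // i ∈ S} => i.1) *
        Matrix.diagonal fun i : {i // i ∈ S} => Υ i.1 := by
    ext i j
    rw [Matrix.mul_diagonal]
    simp [Matrix.toSquareBlockProp, linxFactor, i.2]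
  have hdet : (Matrix.toSquareBlockProp (linxFactor n C Υ S) (fun i => i ∈ S)).det =
      (C.submatrix (fun i : {i // i ∈ S} => i.1) (fun i : {i // i ∈ S} => i.1)).det *
        ∏ i ∈ S, Υ i := by
    rw [hon, Matrix.det_mul, Matrix.det_diagonal, Finset.prod_coe_sort S Υ]
  rw [Matrix.twoBlockTriangular_det _ (fun i => i ∈ S), hoff, Matrix.det_one, mul_one, ← hdet]
  · congr!
  intro i hi j hj
  have hij : i ≠ j := fun h => hi (h ▸ hj)
  simp [linxFactor, hi, hij]

theorem bddAbove_SLinx (n m : ℕ) (C : Matrix (Fin n) (Fin n) ℝ) (A : Matrix (Fin m) (Fin n) ℝ)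
    (b : Fin m → ℝ) (s : ℕ) (Υ : Fin n → ℝ) : BddAbove (SLinx n m C A b s Υ) := by
  have hcont : Continuous fun x : Fin n → ℝ =>
      (1 / 2 : ℝ) * (FLinx n C x Υ).det - ∑ i, x i * Real.log (Υ i) := by
    unfold FLinx
    fun_prop
  obtain ⟨M, hM⟩ := (isCompact_Icc (a := (0 : Fin n → ℝ)) (b := 1)).bddAbove_image
    hcont.continuousOn
  refine ⟨M, ?_⟩
  rintro _ ⟨x, -, hx0, hx1, -, hpd, rfl⟩
  refine le_trans ?_ (hM ⟨x, ⟨hx0, hx1⟩, rfl⟩)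
  have hlog := Real.log_le_self hpd.det_pos.le
  simp only [fLinx]
  linarith

/-- Theorem 2.i: the g-scaled linx bound is a valid upper bound for CMESP. -/
theorem stmt_4 (n m s : ℕ) (hn : 1 < n) (hs0 : 0 < s) (hsn : s < n)
    (C : Matrix (Fin n) (Fin n) ℝ) (hC : C.PosSemidef)
    (A : Matrix (Fin m) (Fin n) ℝ) (b : Fin m → ℝ)
    (Υ : Fin n → ℝ) (hΥ : ∀ i, 0 < Υ i)
    (S : Finset (Fin n)) (hcard : S.card = s)
    (x : Fin n → ℝ) (hx : ∀ i, x i = if i ∈ S then 1 else 0)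
    (hAx : ∀ i, (∑ j, A i j * x j) ≤ b i)
    (hpd : (C.submatrix (fun i : {i // i ∈ S} => i.1)
              (fun i : {i // i ∈ S} => i.1)).PosDef) :
    Real.log (C.submatrix (fun i : {i // i ∈ S} => i.1)
              (fun i : {i // i ∈ S} => i.1)).det ≤ zLinx n m C A b s Υ := by
  set D := C.submatrix (fun i : {i // i ∈ S} => i.1) (fun i : {i // i ∈ S} => i.1)
  have hdetD : 0 < D.det := hpd.det_pos
  have hprod : 0 < ∏ i ∈ S, Υ i := Finset.prod_pos fun i _ => hΥ i
  have hdetB := det_linxFactor n C Υ S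
  have hF := linxFactor_conjTranspose_mul_self n C hC.isHermitian Υ x S hx
  have hdetF : (FLinx n C x Υ).det = (D.det * ∏ i ∈ S, Υ i) ^ 2 := by
    rw [← hF, Matrix.det_mul, Matrix.det_conjTranspose, hdetB, star_trivial, sq]
  have hB : IsUnit (linxFactor n C Υ S) := by
    rw [Matrix.isUnit_iff_isUnit_det, hdetB]
    exact (mul_pos hdetD hprod).ne'.isUnit
  have hsum : ∑ i, x i * Real.log (Υ i) = ∑ i ∈ S, Real.log (Υ i) := by
    simp [hx]
  refine le_csSup (bddAbove_SLinx n m C A b s Υ) ⟨x, ?_, ?_, ?_, hAx, ?_, ?_⟩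
  · simp [hx, hcard]
  · intro i
    rw [hx]
    split_ifs <;> norm_num
  · intro i
    rw [hx]
    split_ifs <;> norm_num
  · rw [← hF]
    exact Matrix.PosDef.conjTranspose_mul_self _ (Matrix.mulVec_injective_of_isUnit hB)
  · rw [fLinx, hdetF, Real.log_pow, Real.log_mul hdetD.ne' hprod.ne',
      Real.log_prod fun i _ => (hΥ i).ne', hsum]
    push_cast
    ring

end
end

section
/- Fix x with 0 ≤ x ≤ e such that F_linx(x;Υ) ≻ 0. Then the map ψ ↦ f_linx(x; exp(ψ)) (exp applied componentwise) is convex on the open set {ψ ∈ R^n : F_linx(x;exp(ψ)) ≻ 0}; that is, f_linx(x;Υ) is convex in log Υ. (Theorem 2.iii, first part) -/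
open Matrix
open scoped Matrix BigOperators

noncomputable section

/-- The determinant of `P + diagonal d` expanded over the set of rows taken from the diagonal. -/
theorem det_add_diagonal_eq_sum {ι : Type*} [Fintype ι] [DecidableEq ι]
    (P : Matrix ι ι ℝ) (d : ι → ℝ) :
    (P + diagonal d).det =
      ∑ S : Finset ι, (∏ i ∈ S, d i) * (P.toSquareBlockProp (fun i => ¬ i ∈ S)).det := by
  have key := (detRowAlternating (R := ℝ) (n := ι)).toMultilinearMap.map_add_univ
    (fun i => diagonal d i) (fun i => P i)
  have hL : (P + diagonal d).det = detRowAlternating (R := ℝ) (n := ι)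
      ((fun i => diagonal d i) + fun i => P i) := by
    rw [add_comm]; rfl
  rw [hL]
  refine key.trans (Finset.sum_congr rfl fun S _ => ?_)
  set M : Matrix ι ι ℝ := S.piecewise (fun i => diagonal d i) (fun i => P i) with hM
  change M.det = _
  rw [twoBlockTriangular_det' M (fun i => i ∈ S)]
  · congr 1
    · have hdiag : M.toSquareBlockProp (fun i => i ∈ S) =
          diagonal (fun i : {i // i ∈ S} => d i) := by
        ext i j
        change M i j = _
        rw [hM, Finset.piecewise_eq_of_mem _ _ _ i.2]
        simp only [diagonal_apply, Subtype.ext_iff]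
      rw [hdiag, Finset.prod_subtype S (fun _ => Iff.rfl) d]
      exact @det_diagonal _ (_) (_) _ _ _
    · congr 1
      ext i j
      change M i j = P i j
      rw [hM, Finset.piecewise_eq_of_notMem _ _ _ i.2]
  · intro i hi j hj
    have hij : i ≠ j := fun h => hj (h ▸ hi)
    rw [hM, Finset.piecewise_eq_of_mem _ _ _ hi, diagonal_apply_ne _ hij]

/-- A nonnegative combination of exponentials is log-convex. -/
theorem log_sum_mul_exp_le {κ : Type*} [Fintype κ] (c u v : κ → ℝ) (hc : ∀ k, 0 ≤ c k)
    {a b : ℝ} (ha : 0 ≤ a) (hb : 0 ≤ b) (hab : a + b = 1)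
    (hu : 0 < ∑ k, c k * Real.exp (u k)) (hv : 0 < ∑ k, c k * Real.exp (v k)) :
    0 < ∑ k, c k * Real.exp (a * u k + b * v k) ∧
    Real.log (∑ k, c k * Real.exp (a * u k + b * v k)) ≤
      a * Real.log (∑ k, c k * Real.exp (u k)) + b * Real.log (∑ k, c k * Real.exp (v k)) := by
  have hpos : 0 < ∑ k, c k * Real.exp (a * u k + b * v k) := by
    obtain ⟨k, -, hk⟩ := Finset.exists_lt_of_sum_lt
      (s := Finset.univ) (f := fun _ : κ => (0 : ℝ)) (g := fun k => c k * Real.exp (u k))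
      (by simpa using hu)
    have hck : 0 < c k := pos_of_mul_pos_left hk (Real.exp_pos _).le
    exact Finset.sum_pos' (fun k _ => mul_nonneg (hc k) (Real.exp_pos _).le)
      ⟨k, Finset.mem_univ k, mul_pos hck (Real.exp_pos _)⟩
  refine ⟨hpos, ?_⟩
  set A := ∑ k, c k * Real.exp (u k) with hA
  set B := ∑ k, c k * Real.exp (v k) with hB
  rw [Real.log_le_iff_le_exp hpos]
  set L := a * Real.log A + b * Real.log B with hL
  have hterm (k : κ) : c k * Real.exp (a * u k + b * v k) ≤
      Real.exp L * (a * (c k * Real.exp (u k)) / A + b * (c k * Real.exp (v k)) / B) := by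
    have h := convexOn_exp.2 (Set.mem_univ (u k - Real.log A)) (Set.mem_univ (v k - Real.log B))
      ha hb hab
    simp only [smul_eq_mul, Real.exp_sub, Real.exp_log hu, Real.exp_log hv] at h
    have hsplit : Real.exp (a * u k + b * v k) =
        Real.exp L * Real.exp (a * (u k - Real.log A) + b * (v k - Real.log B)) := by
      rw [← Real.exp_add, hL]; ring_nf
    rw [hsplit]
    calc _ = (Real.exp L * c k) *
          Real.exp (a * (u k - Real.log A) + b * (v k - Real.log B)) := by ring
      _ ≤ (Real.exp L * c k) * (a * (Real.exp (u k) / A) + b * (Real.exp (v k) / B)) :=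
        mul_le_mul_of_nonneg_left h (mul_nonneg (Real.exp_pos _).le (hc k))
      _ = _ := by ring
  refine (Finset.sum_le_sum fun k _ => hterm k).trans_eq ?_
  rw [← Finset.mul_sum, Finset.sum_add_distrib, ← Finset.sum_div, ← Finset.sum_div,
    ← Finset.mul_sum, ← Finset.mul_sum, ← hA, ← hB, mul_div_assoc, mul_div_assoc,
    div_self hu.ne', div_self hv.ne', mul_one, mul_one, hab, mul_one]

theorem posSemidef_mul_diagonal_mul {n : ℕ} {C : Matrix (Fin n) (Fin n) ℝ} (hC : C.PosSemidef)
    {x : Fin n → ℝ} (hx : ∀ i, 0 ≤ x i) : (C * diagonal x * C).PosSemidef := by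
  have h := (PosSemidef.diagonal (n := Fin n) (d := x) hx).mul_mul_conjTranspose_same C
  rwa [hC.isHermitian.eq] at h

theorem FLinx_posSemidef {n : ℕ} {C : Matrix (Fin n) (Fin n) ℝ} (hC : C.PosSemidef)
    {x : Fin n → ℝ} (hx0 : ∀ i, 0 ≤ x i) (hx1 : ∀ i, x i ≤ 1) (Υ : Fin n → ℝ) :
    (FLinx n C x Υ).PosSemidef := by
  have h := (posSemidef_mul_diagonal_mul hC hx0).mul_mul_conjTranspose_same (diagonal Υ)
  have h' := PosSemidef.diagonal (n := Fin n) (d := fun i => 1 - x i)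
    (fun i => sub_nonneg.2 (hx1 i))
  simpa [FLinx, diagonal_conjTranspose, Matrix.mul_assoc] using h.add h'

theorem FLinx_posDef_iff {n : ℕ} {C : Matrix (Fin n) (Fin n) ℝ} (hC : C.PosSemidef)
    {x : Fin n → ℝ} (hx0 : ∀ i, 0 ≤ x i) (hx1 : ∀ i, x i ≤ 1) (Υ : Fin n → ℝ) :
    (FLinx n C x Υ).PosDef ↔ 0 < (FLinx n C x Υ).det :=
  ⟨fun h => h.det_pos, fun h =>
    (FLinx_posSemidef hC hx0 hx1 Υ).posDef_iff_det_ne_zero.2 (ne_of_gt h)⟩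

/-- In logarithmic scaling variables, `det F_linx` is a combination of exponentials of
linear forms. -/
theorem det_FLinx_exp (n : ℕ) (C : Matrix (Fin n) (Fin n) ℝ) (x ψ : Fin n → ℝ) :
    (FLinx n C x (fun i => Real.exp (ψ i))).det =
      ∑ S : Finset (Fin n), ((∏ i ∈ S, (1 - x i)) *
        ((C * diagonal x * C).toSquareBlockProp (fun i => ¬ i ∈ S)).det) *
          Real.exp (∑ i ∈ Sᶜ, 2 * ψ i) := by
  have hfac : FLinx n C x (fun i => Real.exp (ψ i)) =
      diagonal (fun i => Real.exp (ψ i)) *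
        (C * diagonal x * C + diagonal (fun i => (1 - x i) * Real.exp (-(2 * ψ i)))) *
        diagonal (fun i => Real.exp (ψ i)) := by
    rw [Matrix.mul_add, Matrix.add_mul, diagonal_mul_diagonal, diagonal_mul_diagonal, FLinx]
    simp only [Matrix.mul_assoc]
    congr 3
    ext i
    have : Real.exp (ψ i) * Real.exp (-(2 * ψ i)) * Real.exp (ψ i) = 1 := by
      rw [← Real.exp_add, ← Real.exp_add, ← Real.exp_zero]; ring_nf
    linear_combination (-(1 - x i)) * this
  rw [hfac, det_mul, det_mul, det_diagonal, det_add_diagonal_eq_sum, Finset.mul_sum,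
    Finset.sum_mul]
  refine Finset.sum_congr rfl fun S _ => ?_
  have hexp : (∏ i, Real.exp (ψ i)) * (∏ i ∈ S, Real.exp (-(2 * ψ i))) *
      (∏ i, Real.exp (ψ i)) = Real.exp (∑ i ∈ Sᶜ, 2 * ψ i) := by
    rw [← Real.exp_sum, ← Real.exp_sum, ← Real.exp_add, ← Real.exp_add,
      Finset.sum_neg_distrib, ← Finset.mul_sum, ← Finset.mul_sum,
      ← Finset.sum_add_sum_compl S ψ]
    ring_nf
  rw [Finset.prod_mul_distrib, ← hexp]
  ring

/-- Theorem 2.iii (first part): for fixed `x` with `0 ≤ x ≤ e`, the map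
`ψ ↦ f_linx(x;exp ψ)` is convex on `{ψ : F_linx(x;exp ψ) ≻ 0}`,
i.e. `f_linx(x;Υ)` is convex in `log Υ`. -/
theorem stmt_6 (n : ℕ) (hn : 1 < n)
    (C : Matrix (Fin n) (Fin n) ℝ) (hC : C.PosSemidef)
    (x : Fin n → ℝ) (hx0 : ∀ i, 0 ≤ x i) (hx1 : ∀ i, x i ≤ 1) :
    ConvexOn ℝ
      {ψ : Fin n → ℝ | (FLinx n C x (fun i => Real.exp (ψ i))).PosDef}
      (fun ψ => fLinx n C x (fun i => Real.exp (ψ i))) := by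
  have key : ∀ ψ φ : Fin n → ℝ, 0 < (FLinx n C x (fun i => Real.exp (ψ i))).det →
      0 < (FLinx n C x (fun i => Real.exp (φ i))).det → ∀ a b : ℝ, 0 ≤ a → 0 ≤ b → a + b = 1 →
      0 < (FLinx n C x (fun i => Real.exp ((a • ψ + b • φ) i))).det ∧
      Real.log (FLinx n C x (fun i => Real.exp ((a • ψ + b • φ) i))).det ≤
        a * Real.log (FLinx n C x (fun i => Real.exp (ψ i))).det +
          b * Real.log (FLinx n C x (fun i => Real.exp (φ i))).det := by
    intro ψ φ hψ hφ a b ha hb hab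
    rw [det_FLinx_exp] at hψ hφ
    have hcoeff (S : Finset (Fin n)) : 0 ≤ (∏ i ∈ S, (1 - x i)) *
        ((C * diagonal x * C).toSquareBlockProp (fun i => ¬ i ∈ S)).det :=
      mul_nonneg (Finset.prod_nonneg fun i _ => sub_nonneg.2 (hx1 i))
        ((posSemidef_mul_diagonal_mul hC hx0).submatrix _).det_nonneg
    have h := log_sum_mul_exp_le _ _ _ hcoeff ha hb hab hψ hφ
    have hlin (S : Finset (Fin n)) : ∑ i ∈ Sᶜ, 2 * (a • ψ + b • φ) i =
        a * ∑ i ∈ Sᶜ, 2 * ψ i + b * ∑ i ∈ Sᶜ, 2 * φ i := by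
      rw [Finset.mul_sum, Finset.mul_sum, ← Finset.sum_add_distrib]
      refine Finset.sum_congr rfl fun i _ => ?_
      simp only [Pi.add_apply, Pi.smul_apply, smul_eq_mul]
      ring
    simpa only [det_FLinx_exp, hlin] using h
  simp only [FLinx_posDef_iff hC hx0 hx1]
  refine ⟨fun ψ hψ φ hφ a b ha hb hab => (key ψ φ hψ hφ a b ha hb hab).1,
    fun ψ hψ φ hφ a b ha hb hab => ?_⟩
  have h := (key ψ φ hψ hφ a b ha hb hab).2
  have hlin : ∑ i, x i * (a • ψ + b • φ) i = a * ∑ i, x i * ψ i + b * ∑ i, x i * φ i := by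
    rw [Finset.mul_sum, Finset.mul_sum, ← Finset.sum_add_distrib]
    refine Finset.sum_congr rfl fun i _ => ?_
    simp only [Pi.add_apply, Pi.smul_apply, smul_eq_mul]
    ring
  simp only [fLinx, Real.log_exp, smul_eq_mul, hlin]
  linarith

end
end

section
/- Let λ ∈ R^k with λ_1 ≥ λ_2 ≥ … ≥ λ_k ≥ 0, and let s be an integer with 0 < s ≤ k. Then there exists a unique integer ι with 0 ≤ ι < s such that λ_ι > (1/(s−ι)) Σ_{ℓ=ι+1}^k λ_ℓ ≥ λ_{ι+1}, with the convention λ_0 := +∞. (Lemma 1) -/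
open scoped BigOperators

/-- Splitting off the first term of a sum over `Finset.Icc`. -/
theorem sum_Icc_eq_add_sum_Icc_succ (f : ℕ → ℝ) {i k : ℕ} (h : i ≤ k) :
    ∑ l ∈ Finset.Icc i k, f l = f i + ∑ l ∈ Finset.Icc (i + 1) k, f l := by
  rw [← Finset.insert_Icc_succ_left_eq_Icc h, Finset.sum_insert (by simp)]
  rfl

/-- Lemma 1 (Nikolov): for `λ_1 ≥ … ≥ λ_k ≥ 0` (indexed here by `1,…,k` via `lam : ℕ → ℝ`)
and `0 < s ≤ k`, there is a unique integer `ι` with `0 ≤ ι < s` such that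
`λ_ι > (1/(s−ι)) Σ_{ℓ=ι+1}^k λ_ℓ ≥ λ_{ι+1}`, with the convention `λ_0 = +∞`
(so for `ι = 0` the left inequality is vacuous). -/
theorem stmt_8 (k s : ℕ) (hs0 : 0 < s) (hsk : s ≤ k)
    (lam : ℕ → ℝ)
    (hnn : ∀ i, 1 ≤ i → i ≤ k → 0 ≤ lam i)
    (hmono : ∀ i j, 1 ≤ i → i ≤ j → j ≤ k → lam j ≤ lam i) :
    ∃! ι : ℕ, ι < s ∧
      (1 ≤ ι →
        (1 / ((s : ℝ) - ι)) * ∑ ℓ ∈ Finset.Icc (ι + 1) k, lam ℓ < lam ι) ∧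
      lam (ι + 1) ≤ (1 / ((s : ℝ) - ι)) * ∑ ℓ ∈ Finset.Icc (ι + 1) k, lam ℓ := by
  classical
  set T : ℕ → ℝ := fun i => ∑ l ∈ Finset.Icc (i + 1) k, lam l with hT
  have hstep : ∀ i, i < s → T i = lam (i + 1) + T (i + 1) := fun i hi =>
    sum_Icc_eq_add_sum_Icc_succ lam (by omega)
  have hpos : ∀ i, i < s → (0 : ℝ) < s - i := fun i hi => by
    have : (i : ℝ) < s := by exact_mod_cast hi
    linarith
  let P : ℕ → Prop := fun i => ((s : ℝ) - i) * lam (i + 1) ≤ T i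
  have hright : ∀ i, i < s → (lam (i + 1) ≤ (1 / ((s : ℝ) - i)) * T i ↔ P i) := fun i hi => by
    rw [one_div_mul_eq_div, le_div_iff₀ (hpos i hi), mul_comm]
  have hleft : ∀ i, i + 1 < s →
      ((1 / ((s : ℝ) - (i + 1 : ℕ))) * T (i + 1) < lam (i + 1) ↔ ¬ P i) := fun i hi => by
    rw [one_div_mul_eq_div, div_lt_iff₀ (hpos _ hi)]
    simp only [P, not_le]
    rw [hstep i (by omega)]
    push_cast
    constructor <;> intro h <;> linarith
  have hsucc : ∀ i, i + 1 < s → P i → P (i + 1) := fun i hi h => by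
    simp only [P] at h ⊢
    rw [hstep i (by omega)] at h
    have h1 := mul_le_mul_of_nonneg_left
      (hmono (i + 1) (i + 1 + 1) (by omega) (by omega) (by omega)) (hpos _ hi).le
    push_cast at h1 ⊢
    linarith
  have hup : ∀ i j, i ≤ j → j < s → P i → P j := fun i j hij => by
    induction j, hij using Nat.le_induction with
    | base => exact fun _ h => h
    | succ j _ ih => exact fun hj h => hsucc j hj (ih (by omega) h)
  have hlast : P (s - 1) := by
    have h : 0 ≤ T (s - 1 + 1) := Finset.sum_nonneg fun l hl => by
      rw [Finset.mem_Icc] at hl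
      exact hnn l (by omega) hl.2
    simp only [P]
    rw [hstep (s - 1) (by omega), Nat.cast_sub hs0]
    push_cast
    linarith
  have hex : ∃ i, P i := ⟨_, hlast⟩
  have hlt : Nat.find hex < s := lt_of_le_of_lt (Nat.find_min' hex hlast) (by omega)
  refine ⟨Nat.find hex, ⟨hlt, fun h1 => ?_, (hright _ hlt).2 (Nat.find_spec hex)⟩, ?_⟩
  · obtain ⟨i, hi⟩ := Nat.exists_eq_add_of_le' h1
    have hmin : ¬ P i := Nat.find_min hex (by omega)
    rw [hi] at hlt ⊢
    exact (hleft i hlt).2 hmin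
  · rintro j ⟨hj, hjl, hjr⟩
    refine le_antisymm ?_ (Nat.find_min' hex ((hright j hj).1 hjr))
    by_contra! hlt'
    obtain ⟨i, rfl⟩ := Nat.exists_eq_add_of_le' (show 1 ≤ j by omega)
    exact (hleft i hj).1 (hjl (by omega))
      (hup _ i (by omega) (by omega) (Nat.find_spec hex))
end

section
/- For every scaling vector Υ ∈ R^n_{++} and every x ∈ {0,1}^n with e^⊤x = s, Ax ≤ b, and C[S(x),S(x)] positive definite, one has ldet C[S(x),S(x)] ≤ z_DDFact(Υ). Consequently the optimal value of CMESP is at most the g-scaled factorization bound z_DDFact(Υ). (Theorem 3.i) -/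
open Matrix
open scoped Matrix BigOperators Classical

noncomputable section

/-- `(1/(s−ι)) Σ_{ℓ=ι+1}^k λ_ℓ` (eigenvalues indexed from `1`). -/
def avgTail (k s : ℕ) (lam : ℕ → ℝ) (ι : ℕ) : ℝ :=
  (∑ ℓ ∈ Finset.Icc (ι + 1) k, lam ℓ) / ((s : ℝ) - ι)

/-- The defining property of the unique index `ι` of Lemma 1
(with the convention `λ_0 = +∞`, so for `ι = 0` the left inequality is vacuous). -/
def IsIota (k s : ℕ) (lam : ℕ → ℝ) (ι : ℕ) : Prop :=
  ι < s ∧ (1 ≤ ι → avgTail k s lam ι < lam ι) ∧ lam (ι + 1) ≤ avgTail k s lam ι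

/-- The unique index `ι` of Lemma 1 (junk value `0` if no such index exists). -/
def iotaOf (k s : ℕ) (lam : ℕ → ℝ) : ℕ :=
  if h : ∃ ι, IsIota k s lam ι then h.choose else 0

/-- `φ_s(λ) = Σ_{ℓ=1}^ι log λ_ℓ + (s−ι) log((1/(s−ι)) Σ_{ℓ=ι+1}^k λ_ℓ)`. -/
def phiS (k s : ℕ) (lam : ℕ → ℝ) : ℝ :=
  (∑ ℓ ∈ Finset.Icc 1 (iotaOf k s lam), Real.log (lam ℓ)) +
    ((s : ℝ) - iotaOf k s lam) * Real.log (avgTail k s lam (iotaOf k s lam))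

/-- The decreasingly ordered eigenvalues of a symmetric matrix, indexed from `1`
(junk value `0` outside `[1,k]` or if `X` is not Hermitian). -/
def eigsDesc (k : ℕ) (X : Matrix (Fin k) (Fin k) ℝ) : ℕ → ℝ := fun i =>
  if h : X.IsHermitian then
    ((((List.ofFn h.eigenvalues : List ℝ) : Multiset ℝ).sort (· ≤ ·)).reverse).getD (i - 1) 0
  else 0

/-- `Γ_s(X) = φ_s(λ(X))` with `λ(X)` the decreasingly ordered eigenvalues of `X`. -/
def gammaS (k s : ℕ) (X : Matrix (Fin k) (Fin k) ℝ) : ℝ :=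
  phiS k s (eigsDesc k X)

/-- `F_DDFact(x;Υ) = Fᵀ Diag(Υ∘x) F = Σ_i γ_i x_i F_{i·}ᵀ F_{i·}`. -/
def FDD (n k : ℕ) (F : Matrix (Fin n) (Fin k) ℝ) (x Υ : Fin n → ℝ) :
    Matrix (Fin k) (Fin k) ℝ :=
  Fᵀ * Matrix.diagonal (fun i => Υ i * x i) * F

/-- `f_DDFact(x;Υ) = Γ_s(F_DDFact(x;Υ)) − Σ_i x_i log γ_i`. -/
def fDD (n k s : ℕ) (F : Matrix (Fin n) (Fin k) ℝ) (x Υ : Fin n → ℝ) : ℝ :=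
  gammaS k s (FDD n k F x Υ) - ∑ i, x i * Real.log (Υ i)

/-- `β` of Definition 1: `β_i = 1/λ_i` for `i ≤ ι` and
`β_i = (s−ι)/Σ_{ℓ=ι+1}^k λ_ℓ` for `i > ι` (here `β` is indexed by `Fin k`, `j ↔ j+1`). -/
def betaOf (k s : ℕ) (lam : ℕ → ℝ) : Fin k → ℝ := fun j =>
  if (j : ℕ) + 1 ≤ iotaOf k s lam then (lam ((j : ℕ) + 1))⁻¹
  else ((s : ℝ) - iotaOf k s lam) / ∑ ℓ ∈ Finset.Icc (iotaOf k s lam + 1) k, lam ℓ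

/-- `F Q Diag(β) Qᵀ Fᵀ`, whose diagonal appears in the (generalized) gradients. -/
def gMat (n k s : ℕ) (F : Matrix (Fin n) (Fin k) ℝ) (Q : Matrix (Fin k) (Fin k) ℝ)
    (lam : ℕ → ℝ) : Matrix (Fin n) (Fin n) ℝ :=
  F * Q * Matrix.diagonal (betaOf k s lam) * Qᵀ * Fᵀ

/-- `Q, λ` form a spectral decomposition of `F_DDFact(x;Υ)` as in Definition 1:
`Q` orthonormal and `F_DDFact(x;Υ) = Q Diag(λ) Qᵀ` with `λ` decreasing and nonnegative
(indexed from `1`). -/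
def IsSpectralDecomp (n k : ℕ) (F : Matrix (Fin n) (Fin k) ℝ) (x Υ : Fin n → ℝ)
    (Q : Matrix (Fin k) (Fin k) ℝ) (lam : ℕ → ℝ) : Prop :=
  Q * Qᵀ = 1 ∧
  FDD n k F x Υ = Q * Matrix.diagonal (fun j : Fin k => lam ((j : ℕ) + 1)) * Qᵀ ∧
  (∀ i, 0 ≤ lam i) ∧
  (∀ i j, 1 ≤ i → i ≤ j → j ≤ k → lam j ≤ lam i)

/-- Euclidean (2-)norm of a vector in `ℝⁿ`. -/
def enorm2 (n : ℕ) (v : Fin n → ℝ) : ℝ :=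
  Real.sqrt (∑ i, (v i) ^ 2)

/-- The set of objective values of feasible points of the g-scaled factorization relaxation. -/
def SDD (n m k s : ℕ) (F : Matrix (Fin n) (Fin k) ℝ) (A : Matrix (Fin m) (Fin n) ℝ)
    (b : Fin m → ℝ) (Υ : Fin n → ℝ) : Set ℝ :=
  { v : ℝ | ∃ x : Fin n → ℝ, (∑ i, x i) = (s : ℝ) ∧ (∀ i, 0 ≤ x i) ∧ (∀ i, x i ≤ 1) ∧
      (∀ i, (∑ j, A i j * x j) ≤ b i) ∧ s ≤ (FDD n k F x Υ).rank ∧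
      v = fDD n k s F x Υ }

/-- The g-scaled factorization bound `z_DDFact(Υ)`. -/
def zDD (n m k s : ℕ) (F : Matrix (Fin n) (Fin k) ℝ) (A : Matrix (Fin m) (Fin n) ℝ)
    (b : Fin m → ℝ) (Υ : Fin n → ℝ) : ℝ :=
  sSup (SDD n m k s F A b Υ)

theorem iotaOf_lt {k s : ℕ} (hs : 0 < s) (lam : ℕ → ℝ) : iotaOf k s lam < s := by
  unfold iotaOf
  split_ifs with h
  · exact h.choose_spec.1
  · exact hs

/-- `φ_s(λ)` is at most the sum of the entries of a nonnegative `λ`. -/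
theorem phiS_le_sum {k s : ℕ} (hs : 0 < s) (hsk : s ≤ k) {lam : ℕ → ℝ} (h0 : ∀ i, 0 ≤ lam i) :
    phiS k s lam ≤ ∑ ℓ ∈ Finset.Icc 1 k, lam ℓ := by
  have hι := iotaOf_lt (k := k) hs lam
  unfold phiS avgTail
  generalize iotaOf k s lam = ι at hι
  have hpos : (0 : ℝ) < (s : ℝ) - ι := sub_pos.2 (by exact_mod_cast hι)
  have hlog : ∀ y : ℝ, 0 ≤ y → Real.log y ≤ y := fun y hy => Real.log_le_self hy
  have hT : 0 ≤ ∑ ℓ ∈ Finset.Icc (ι + 1) k, lam ℓ := Finset.sum_nonneg fun i _ => h0 i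
  have h1 : ∑ ℓ ∈ Finset.Icc 1 ι, Real.log (lam ℓ) ≤ ∑ ℓ ∈ Finset.Icc 1 ι, lam ℓ :=
    Finset.sum_le_sum fun i _ => hlog _ (h0 i)
  have h2 := mul_le_mul_of_nonneg_left (hlog _ (div_nonneg hT hpos.le)) hpos.le
  rw [mul_div_cancel₀ _ hpos.ne'] at h2
  have h3 : ∑ ℓ ∈ Finset.Icc 1 k, lam ℓ
      = ∑ ℓ ∈ Finset.Icc 1 ι, lam ℓ + ∑ ℓ ∈ Finset.Icc (ι + 1) k, lam ℓ := by
    have := Finset.sum_Ioc_consecutive lam (Nat.zero_le ι) (hι.le.trans hsk)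
    simpa [← Finset.Icc_add_one_left_eq_Ioc] using this.symm
  linarith

/-- By concavity of the logarithm, `φ_s(λ)` is at least `Σ_{ℓ=1}^s log λ_ℓ`. -/
theorem sum_log_le_phiS {k s : ℕ} (hs : 0 < s) (hsk : s ≤ k) {lam : ℕ → ℝ}
    (h0 : ∀ i, 0 ≤ lam i) (hp : ∀ i, 1 ≤ i → i ≤ s → 0 < lam i) :
    ∑ ℓ ∈ Finset.Icc 1 s, Real.log (lam ℓ) ≤ phiS k s lam := by
  have hι := iotaOf_lt (k := k) hs lam
  unfold phiS
  generalize iotaOf k s lam = ι at hι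
  have hpos : (0 : ℝ) < (s : ℝ) - ι := sub_pos.2 (by exact_mod_cast hι)
  have hle : ∑ ℓ ∈ Finset.Icc (ι + 1) s, lam ℓ ≤ ∑ ℓ ∈ Finset.Icc (ι + 1) k, lam ℓ :=
    Finset.sum_le_sum_of_subset_of_nonneg (Finset.Icc_subset_Icc_right hsk) fun i _ _ => h0 i
  have hT : 0 < ∑ ℓ ∈ Finset.Icc (ι + 1) s, lam ℓ :=
    Finset.sum_pos (fun i hi => hp i (by grind) (by grind)) ⟨s, by grind⟩
  have ha : 0 < avgTail k s lam ι := div_pos (hT.trans_le hle) hpos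
  have hsum : ((s : ℝ) - ι) * avgTail k s lam ι = ∑ ℓ ∈ Finset.Icc (ι + 1) k, lam ℓ :=
    mul_div_cancel₀ _ hpos.ne'
  generalize avgTail k s lam ι = a at ha hsum
  have hsplit : ∑ ℓ ∈ Finset.Icc 1 s, Real.log (lam ℓ)
      = ∑ ℓ ∈ Finset.Icc 1 ι, Real.log (lam ℓ)
        + ∑ ℓ ∈ Finset.Icc (ι + 1) s, Real.log (lam ℓ) := by
    have := Finset.sum_Ioc_consecutive (fun ℓ => Real.log (lam ℓ)) (Nat.zero_le ι) hι.le
    simpa [← Finset.Icc_add_one_left_eq_Ioc] using this.symm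
  have hterm : ∑ ℓ ∈ Finset.Icc (ι + 1) s, Real.log (lam ℓ)
      ≤ ∑ ℓ ∈ Finset.Icc (ι + 1) s, (Real.log a - 1 + lam ℓ / a) := by
    refine Finset.sum_le_sum fun i hi => ?_
    have hi' : 0 < lam i := hp i (by grind) (by grind)
    have := Real.log_le_sub_one_of_pos (div_pos hi' ha)
    rw [Real.log_div hi'.ne' ha.ne'] at this
    linarith
  have hcard : ((Finset.Icc (ι + 1) s).card : ℝ) = (s : ℝ) - ι := by
    rw [Nat.card_Icc, show s + 1 - (ι + 1) = s - ι by lia, Nat.cast_sub hι.le]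
  rw [Finset.sum_add_distrib, Finset.sum_const, nsmul_eq_mul, hcard, ← Finset.sum_div] at hterm
  have hdiv : (∑ ℓ ∈ Finset.Icc (ι + 1) s, lam ℓ) / a ≤ (s : ℝ) - ι := by
    rw [div_le_iff₀ ha, hsum]
    exact hle
  linarith

/-- The ordered eigenvalues are the entries of a decreasing list of the roots of the
characteristic polynomial. -/
theorem exists_list_eigsDesc {k : ℕ} {X : Matrix (Fin k) (Fin k) ℝ} (hX : X.IsHermitian) :
    ∃ l : List ℝ, l.Pairwise (· ≥ ·) ∧ (l : Multiset ℝ) = X.charpoly.roots ∧ l.length = k ∧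
      eigsDesc k X = fun i => l.getD (i - 1) 0 := by
  refine ⟨(((List.ofFn hX.eigenvalues : List ℝ) : Multiset ℝ).sort (· ≤ ·)).reverse,
    ?_, ?_, ?_, ?_⟩
  · rw [List.pairwise_reverse]
    exact Multiset.pairwise_sort _ _
  · rw [Multiset.coe_reverse, Multiset.sort_eq, hX.roots_charpoly_eq_eigenvalues,
      Fin.univ_val_map]
    rfl
  · simp
  · funext i
    simp only [eigsDesc, dif_pos hX]

theorem eigsDesc_nonneg {k : ℕ} {X : Matrix (Fin k) (Fin k) ℝ} (hX : X.PosSemidef) (i : ℕ) :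
    0 ≤ eigsDesc k X i := by
  obtain ⟨l, -, hl, -, h⟩ := exists_list_eigsDesc hX.isHermitian
  have hmem : ∀ y ∈ l, 0 ≤ y := by
    intro y hy
    rw [← Multiset.mem_coe, hl, hX.isHermitian.roots_charpoly_eq_eigenvalues] at hy
    obtain ⟨j, -, rfl⟩ := Multiset.mem_map.1 hy
    exact hX.eigenvalues_nonneg j
  rw [h]
  dsimp only
  by_cases hi : i - 1 < l.length
  · rw [List.getD_eq_getElem _ _ hi]
    exact hmem _ (List.getElem_mem hi)
  · rw [List.getD_eq_default _ _ (not_lt.1 hi)]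

theorem sum_Icc_getD (l : List ℝ) (f : ℝ → ℝ) :
    ∑ ℓ ∈ Finset.Icc 1 l.length, f (l.getD (ℓ - 1) 0) = (l.map f).sum := by
  have hshift : ∑ ℓ ∈ Finset.Icc 1 l.length, f (l.getD (ℓ - 1) 0)
      = ∑ i ∈ Finset.range l.length, f (l.getD i 0) :=
    Finset.sum_nbij' (fun ℓ => ℓ - 1) (fun i => i + 1) (by grind) (by grind) (by grind) (by grind)
      (by grind)
  rw [hshift]
  clear hshift
  induction l with
  | nil => simp
  | cons a l ih =>
    rw [List.length_cons, Finset.sum_range_succ', List.map_cons, List.sum_cons, ← ih, add_comm]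
    simp

theorem sum_eigsDesc {k : ℕ} {X : Matrix (Fin k) (Fin k) ℝ} (hX : X.IsHermitian) :
    ∑ ℓ ∈ Finset.Icc 1 k, eigsDesc k X ℓ = X.trace := by
  obtain ⟨l, -, hl, hk, h⟩ := exists_list_eigsDesc hX
  have := sum_Icc_getD l id
  rw [hk, List.map_id] at this
  rw [h]
  refine this.trans ?_
  rw [← Multiset.sum_coe, hl, Matrix.trace_eq_sum_roots_charpoly_of_splits hX.splits_charpoly]

/-- If the nonzero part of the spectrum of `X` is that of a positive definite `M` of order `s`,
then `Γ_s(X) ≥ log det M`. -/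
theorem log_det_le_gammaS {ι : Type*} [Fintype ι] [DecidableEq ι] {k s : ℕ} (hs : 0 < s)
    (hsk : s ≤ k) {X : Matrix (Fin k) (Fin k) ℝ} (hX : X.PosSemidef) {M : Matrix ι ι ℝ}
    (hM : M.PosDef) (hcard : Fintype.card ι = s)
    (hchar : X.charpoly = Polynomial.X ^ (k - s) * M.charpoly) :
    Real.log M.det ≤ gammaS k s X := by
  obtain ⟨l, hsort, hl, hk, h⟩ := exists_list_eigsDesc hX.isHermitian
  set l₁ : List ℝ := M.charpoly.roots.sort (· ≥ ·) with hl₁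
  have hroots : X.charpoly.roots = Multiset.replicate (k - s) 0 + M.charpoly.roots := by
    rw [hchar, Polynomial.roots_mul, Polynomial.roots_X_pow, Multiset.nsmul_singleton]
    exact hchar ▸ X.charpoly_monic.ne_zero
  have hpos : ∀ y ∈ l₁, 0 < y := by
    intro y hy
    rw [hl₁, Multiset.mem_sort, hM.isHermitian.roots_charpoly_eq_eigenvalues] at hy
    obtain ⟨j, -, rfl⟩ := Multiset.mem_map.1 hy
    exact hM.eigenvalues_pos j
  have hlen : l₁.length = s := by
    rw [hl₁, Multiset.length_sort, hM.isHermitian.roots_charpoly_eq_eigenvalues,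
      Multiset.card_map, ← hcard]
    rfl
  have hl_eq : l = l₁ ++ List.replicate (k - s) 0 := by
    refine List.Perm.eq_of_pairwise' (r := (· ≥ ·)) hsort ?_ ?_
    · rw [List.pairwise_append]
      refine ⟨Multiset.pairwise_sort _ _, List.pairwise_replicate.2 (Or.inr le_rfl), ?_⟩
      intro a ha c hc
      rw [(List.mem_replicate.1 hc).2]
      exact (hpos a ha).le
    · rw [← Multiset.coe_eq_coe, hl, hroots, ← Multiset.coe_add, hl₁, Multiset.sort_eq,
        Multiset.coe_replicate, add_comm]
  have hget : ∀ i, 1 ≤ i → i ≤ s → eigsDesc k X i = l₁.getD (i - 1) 0 := by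
    intro i h1 h2
    rw [h, hl_eq]
    exact List.getD_append _ _ _ _ (by lia)
  have hsum : ∑ ℓ ∈ Finset.Icc 1 s, Real.log (eigsDesc k X ℓ) = Real.log M.det := by
    have h1 : ∑ ℓ ∈ Finset.Icc 1 s, Real.log (eigsDesc k X ℓ)
        = ∑ ℓ ∈ Finset.Icc 1 l₁.length, Real.log (l₁.getD (ℓ - 1) 0) := by
      rw [hlen]
      refine Finset.sum_congr rfl fun i hi => ?_
      rw [hget i (Finset.mem_Icc.1 hi).1 (Finset.mem_Icc.1 hi).2]
    rw [h1, sum_Icc_getD, ← Real.log_list_prod fun y hy => (hpos y hy).ne',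
      Matrix.det_eq_prod_roots_charpoly_of_splits hM.isHermitian.splits_charpoly,
      ← Multiset.prod_coe, hl₁, Multiset.sort_eq]
  rw [← hsum]
  refine sum_log_le_phiS hs hsk (eigsDesc_nonneg hX) fun i h1 h2 => ?_
  rw [hget i h1 h2, List.getD_eq_getElem _ _ (by lia)]
  exact hpos _ (List.getElem_mem _)

theorem posSemidef_FDD {n k : ℕ} (F : Matrix (Fin n) (Fin k) ℝ) {x Υ : Fin n → ℝ}
    (hx : ∀ i, 0 ≤ x i) (hΥ : ∀ i, 0 < Υ i) : (FDD n k F x Υ).PosSemidef := by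
  have := (Matrix.PosSemidef.diagonal (n := Fin n) (d := fun i => Υ i * x i)
    fun i => mul_nonneg (hΥ i).le (hx i)).conjTranspose_mul_mul_same F
  simpa [FDD, Matrix.conjTranspose_eq_transpose_of_trivial] using this

theorem trace_FDD {n k : ℕ} (F : Matrix (Fin n) (Fin k) ℝ) (x Υ : Fin n → ℝ) :
    (FDD n k F x Υ).trace = ∑ i, Υ i * x i * (F * Fᵀ) i i := by
  rw [FDD, Matrix.mul_assoc, Matrix.trace_mul_comm, Matrix.mul_assoc, Matrix.trace]
  simp [Matrix.diagonal_mul]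

/-- The objective of the g-scaled factorization relaxation is bounded above. -/
theorem bddAbove_SDD {n m k s : ℕ} (hs : 0 < s) (hsk : s ≤ k) (F : Matrix (Fin n) (Fin k) ℝ)
    (A : Matrix (Fin m) (Fin n) ℝ) (b : Fin m → ℝ) {Υ : Fin n → ℝ} (hΥ : ∀ i, 0 < Υ i) :
    BddAbove (SDD n m k s F A b Υ) := by
  refine ⟨∑ i, Υ i * (F * Fᵀ) i i + ∑ i, |Real.log (Υ i)|, ?_⟩
  rintro v ⟨x, -, h0, h1, -, -, rfl⟩
  have hX := posSemidef_FDD F h0 hΥ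
  have hphi := phiS_le_sum hs hsk (eigsDesc_nonneg hX)
  rw [sum_eigsDesc hX.isHermitian, trace_FDD] at hphi
  have htr : ∑ i, Υ i * x i * (F * Fᵀ) i i ≤ ∑ i, Υ i * (F * Fᵀ) i i := by
    refine Finset.sum_le_sum fun i _ => mul_le_mul_of_nonneg_right
      (mul_le_of_le_one_right (hΥ i).le (h1 i)) ?_
    rw [Matrix.mul_apply]
    exact Finset.sum_nonneg fun j _ => mul_self_nonneg _
  have hlog : ∑ i, -(x i * Real.log (Υ i)) ≤ ∑ i, |Real.log (Υ i)| := by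
    refine Finset.sum_le_sum fun i _ => (neg_le_abs _).trans ?_
    rw [abs_mul, abs_of_nonneg (h0 i)]
    exact mul_le_of_le_one_left (abs_nonneg _) (h1 i)
  rw [Finset.sum_neg_distrib] at hlog
  unfold fDD gammaS
  linarith

/-- The rows of `F` in `S`, scaled by the square roots of the scaling vector. -/
def scaledRows {n k : ℕ} (F : Matrix (Fin n) (Fin k) ℝ) (Υ : Fin n → ℝ) (S : Finset (Fin n)) :
    Matrix {i // i ∈ S} (Fin k) ℝ :=
  Matrix.of fun i j => √(Υ i) * F i j

theorem FDD_indicator {n k : ℕ} (F : Matrix (Fin n) (Fin k) ℝ) {x Υ : Fin n → ℝ}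
    (hΥ : ∀ i, 0 < Υ i) {S : Finset (Fin n)} (hx : ∀ i, x i = if i ∈ S then 1 else 0) :
    FDD n k F x Υ = (scaledRows F Υ S)ᵀ * scaledRows F Υ S := by
  ext a c
  rw [FDD, Matrix.mul_apply, Matrix.mul_apply]
  simp only [scaledRows, Matrix.mul_diagonal, Matrix.transpose_apply, Matrix.of_apply]
  rw [Finset.sum_coe_sort S (fun i => √(Υ i) * F i a * (√(Υ i) * F i c)),
    ← Finset.sum_subset (Finset.subset_univ S)]
  · refine Finset.sum_congr rfl fun i hi => ?_
    rw [hx, if_pos hi]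
    linear_combination (-F i a * F i c) * Real.mul_self_sqrt (hΥ i).le
  · intro i _ hi
    simp [hx, hi]

theorem scaledRows_mul_transpose {n k : ℕ} (F : Matrix (Fin n) (Fin k) ℝ) (Υ : Fin n → ℝ)
    (S : Finset (Fin n)) :
    scaledRows F Υ S * (scaledRows F Υ S)ᵀ
      = Matrix.diagonal (fun i : {i // i ∈ S} => √(Υ i))
        * (F * Fᵀ).submatrix (fun i : {i // i ∈ S} => i.1) (fun i : {i // i ∈ S} => i.1)
        * Matrix.diagonal (fun i : {i // i ∈ S} => √(Υ i)) := by
  ext i j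
  rw [Matrix.mul_diagonal, Matrix.diagonal_mul, Matrix.submatrix_apply, Matrix.mul_apply,
    Matrix.mul_apply, Finset.mul_sum, Finset.sum_mul]
  simp only [scaledRows, Matrix.transpose_apply, Matrix.of_apply]
  exact Finset.sum_congr rfl fun _ _ => by ring

/-- Theorem 3.i: the g-scaled factorization bound is a valid upper bound for CMESP. -/
theorem stmt_9 (n m k s r : ℕ) (hn : 1 < n) (hs0 : 0 < s) (hsn : s < n)
    (C : Matrix (Fin n) (Fin n) ℝ) (hC : C.PosSemidef)
    (hr : C.rank = r) (hrs : s ≤ r)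
    (F : Matrix (Fin n) (Fin k) ℝ) (hF : C = F * Fᵀ) (hk1 : r ≤ k) (hk2 : k ≤ n)
    (A : Matrix (Fin m) (Fin n) ℝ) (b : Fin m → ℝ)
    (Υ : Fin n → ℝ) (hΥ : ∀ i, 0 < Υ i)
    (S : Finset (Fin n)) (hcard : S.card = s)
    (x : Fin n → ℝ) (hx : ∀ i, x i = if i ∈ S then 1 else 0)
    (hAx : ∀ i, (∑ j, A i j * x j) ≤ b i)
    (hpd : (C.submatrix (fun i : {i // i ∈ S} => i.1)
              (fun i : {i // i ∈ S} => i.1)).PosDef) :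
    Real.log (C.submatrix (fun i : {i // i ∈ S} => i.1)
              (fun i : {i // i ∈ S} => i.1)).det ≤ zDD n m k s F A b Υ := by
  subst hF
  set CS := (F * Fᵀ).submatrix (fun i : {i // i ∈ S} => i.1) (fun i : {i // i ∈ S} => i.1)
  set G := scaledRows F Υ S with hG
  have hsk : s ≤ k := hrs.trans hk1
  have hcardS : Fintype.card {i // i ∈ S} = s := by rw [Fintype.card_coe, hcard]
  have hx0 : ∀ i, 0 ≤ x i := fun i => by rw [hx]; split_ifs <;> norm_num
  have hx1 : ∀ i, x i ≤ 1 := fun i => by rw [hx]; split_ifs <;> norm_num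
  have hdet : (G * Gᵀ).det = (∏ i ∈ S, Υ i) * CS.det := by
    rw [hG, scaledRows_mul_transpose, Matrix.det_mul, Matrix.det_mul, Matrix.det_diagonal,
      ← Finset.prod_coe_sort S Υ, mul_right_comm, ← Finset.prod_mul_distrib]
    simp only [Real.mul_self_sqrt (hΥ _).le]
    rfl
  have hprod : 0 < ∏ i ∈ S, Υ i := Finset.prod_pos fun i _ => hΥ i
  have hdetpos : 0 < (G * Gᵀ).det := hdet ▸ mul_pos hprod hpd.det_pos
  have hunit : IsUnit (G * Gᵀ) := (Matrix.isUnit_iff_isUnit_det _).2 hdetpos.ne'.isUnit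
  have hMpsd : (G * Gᵀ).PosSemidef := by
    simpa [Matrix.conjTranspose_eq_transpose_of_trivial] using
      Matrix.posSemidef_self_mul_conjTranspose G
  have hM : (G * Gᵀ).PosDef := hMpsd.posDef_iff_isUnit.2 hunit
  have hX := FDD_indicator F hΥ hx
  have hchar : (FDD n k F x Υ).charpoly = Polynomial.X ^ (k - s) * (G * Gᵀ).charpoly := by
    rw [hX, Matrix.charpoly_mul_comm_of_le _ _ (by rw [hcardS, Fintype.card_fin]; exact hsk),
      hcardS, Fintype.card_fin]
  have hgamma := log_det_le_gammaS hs0 hsk (posSemidef_FDD F hx0 hΥ) hM hcardS hchar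
  have hmem : fDD n k s F x Υ ∈ SDD n m k s F A b Υ := by
    refine ⟨x, ?_, hx0, hx1, hAx, ?_, rfl⟩
    · simp [hx, hcard]
    · rw [hX, Matrix.rank_transpose_mul_self, ← Matrix.rank_self_mul_transpose,
        Matrix.rank_of_isUnit _ hunit, hcardS]
  refine le_trans ?_ (le_csSup (bddAbove_SDD hs0 hsk F A b hΥ) hmem)
  have hlog : ∑ i, x i * Real.log (Υ i) = Real.log (∏ i ∈ S, Υ i) := by
    rw [Real.log_prod fun i _ => (hΥ i).ne']
    simp [hx]
  rw [hdet, Real.log_mul hprod.ne' hpd.det_pos.ne'] at hgamma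
  rw [fDD, hlog]
  linarith

end
end
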